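/- (Promotion) Given a valid typing judgment Δ ⊢ V : A where V is a value, there exists a canonical value V' such that Erase(V') = Erase(V) and !Δ ⊢ V' : !A is a valid typing judgment. -/

import Mathlib

/- The call-by-value linear lambda calculus of Selinger-Valiron:
   types, subtyping, indexed terms, values, erasure, contexts, typing rules. -/

namespace QLam

/-- Types: A,B ::= α | A ⊸ B | A ⊗ B | ⊤ | !A -/
inductive Ty : Type where
  | tconst : ℕ → Ty
  | arrow : Ty → Ty → Ty
  | tensor : Ty → Ty → Ty
  | unit : Ty
  | bang : Ty → Ty
deriving DecidableEq

/-- `bangN n A` is `!ⁿA`. -/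
def bangN : ℕ → Ty → Ty
  | 0, A => A
  | n + 1, A => Ty.bang (bangN n A)

/-- The subtyping relation `A <: B`. -/
inductive Sub : Ty → Ty → Prop where
  | tconst (n m a : ℕ) : (m = 0 ∨ 1 ≤ n) →
      Sub (bangN n (Ty.tconst a)) (bangN m (Ty.tconst a))
  | unit (n m : ℕ) : (m = 0 ∨ 1 ≤ n) →
      Sub (bangN n Ty.unit) (bangN m Ty.unit)
  | arrow (n m : ℕ) (A A' B B' : Ty) : (m = 0 ∨ 1 ≤ n) → Sub A A' → Sub B B' →
      Sub (bangN n (Ty.arrow A' B)) (bangN m (Ty.arrow A B'))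
  | tensor (n m : ℕ) (A A' B B' : Ty) : (m = 0 ∨ 1 ≤ n) → Sub A A' → Sub B B' →
      Sub (bangN n (Ty.tensor A B)) (bangN m (Ty.tensor A' B'))

/-- Indexed terms.  `letv x A M N` is `let x^A = M in N` (the abbreviation of
    `(λ⁰x^A.N) M`), `letPair n x A y B M N` is `let ⟨x^A,y^B⟩ⁿ = M in N`,
    `letUnit M N` is `let ∗ = M in N`, `star n` is `∗ⁿ`, `lam n x A M` is `λⁿx^A.M`. -/
inductive Tm : Type where
  | var : ℕ → Ty → Tm
  | cst : ℕ → Ty → Tm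
  | star : ℕ → Tm
  | lam : ℕ → ℕ → Ty → Tm → Tm
  | app : Tm → Tm → Tm
  | pair : ℕ → Tm → Tm → Tm
  | letv : ℕ → Ty → Tm → Tm → Tm
  | letPair : ℕ → ℕ → Ty → ℕ → Ty → Tm → Tm → Tm
  | letUnit : Tm → Tm → Tm
deriving DecidableEq

/-- Core values U ::= x^A | c^A | ∗ⁿ | λⁿx^A.M -/
inductive IsCoreValue : Tm → Prop where
  | var (x : ℕ) (A : Ty) : IsCoreValue (.var x A)
  | cst (c : ℕ) (A : Ty) : IsCoreValue (.cst c A)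
  | star (n : ℕ) : IsCoreValue (.star n)
  | lam (n x : ℕ) (A : Ty) (M : Tm) : IsCoreValue (.lam n x A M)

/-- Values V,W ::= U | ⟨V,W⟩ⁿ | let x^A = V in W | let ⟨x^A,y^B⟩ⁿ = V in W | let ∗ = V in W -/
inductive IsValue : Tm → Prop where
  | core {U : Tm} : IsCoreValue U → IsValue U
  | pair {V W : Tm} (n : ℕ) : IsValue V → IsValue W → IsValue (.pair n V W)
  | letv {V W : Tm} (x : ℕ) (A : Ty) : IsValue V → IsValue W → IsValue (.letv x A V W)
  | letPair {V W : Tm} (n x : ℕ) (A : Ty) (y : ℕ) (B : Ty) :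
      IsValue V → IsValue W → IsValue (.letPair n x A y B V W)
  | letUnit {V W : Tm} : IsValue V → IsValue W → IsValue (.letUnit V W)

/-- Untyped (pure) terms. -/
inductive PTm : Type where
  | var : ℕ → PTm
  | cst : ℕ → PTm
  | star : PTm
  | lam : ℕ → PTm → PTm
  | app : PTm → PTm → PTm
  | pair : PTm → PTm → PTm
  | letv : ℕ → PTm → PTm → PTm
  | letPair : ℕ → ℕ → PTm → PTm → PTm
  | letUnit : PTm → PTm → PTm
deriving DecidableEq

/-- The erasure operation, deleting all type and integer annotations. -/
def erase : Tm → PTm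
  | .var x _ => .var x
  | .cst c _ => .cst c
  | .star _ => .star
  | .lam _ x _ M => .lam x (erase M)
  | .app M N => .app (erase M) (erase N)
  | .pair _ M N => .pair (erase M) (erase N)
  | .letv x _ M N => .letv x (erase M) (erase N)
  | .letPair _ x _ y _ M N => .letPair x y (erase M) (erase N)
  | .letUnit M N => .letUnit (erase M) (erase N)

/-- `FreeAt x A M` : the term `M` has a free instance `x^A` of the variable `x`. -/
inductive FreeAt (x : ℕ) : Ty → Tm → Prop where
  | var (A : Ty) : FreeAt x A (.var x A)
  | lam {A : Ty} {M : Tm} (n y : ℕ) (B : Ty) : y ≠ x → FreeAt x A M →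
      FreeAt x A (.lam n y B M)
  | appL {A : Ty} {M : Tm} (N : Tm) : FreeAt x A M → FreeAt x A (.app M N)
  | appR {A : Ty} {N : Tm} (M : Tm) : FreeAt x A N → FreeAt x A (.app M N)
  | pairL {A : Ty} {M : Tm} (n : ℕ) (N : Tm) : FreeAt x A M → FreeAt x A (.pair n M N)
  | pairR {A : Ty} {N : Tm} (n : ℕ) (M : Tm) : FreeAt x A N → FreeAt x A (.pair n M N)
  | letvL {A : Ty} {M : Tm} (y : ℕ) (B : Ty) (N : Tm) : FreeAt x A M →
      FreeAt x A (.letv y B M N)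
  | letvR {A : Ty} {N : Tm} (y : ℕ) (B : Ty) (M : Tm) : y ≠ x → FreeAt x A N →
      FreeAt x A (.letv y B M N)
  | letPairL {A : Ty} {M : Tm} (n y : ℕ) (B : Ty) (z : ℕ) (C : Ty) (N : Tm) :
      FreeAt x A M → FreeAt x A (.letPair n y B z C M N)
  | letPairR {A : Ty} {N : Tm} (n y : ℕ) (B : Ty) (z : ℕ) (C : Ty) (M : Tm) :
      y ≠ x → z ≠ x → FreeAt x A N → FreeAt x A (.letPair n y B z C M N)
  | letUnitL {A : Ty} {M : Tm} (N : Tm) : FreeAt x A M → FreeAt x A (.letUnit M N)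
  | letUnitR {A : Ty} {N : Tm} (M : Tm) : FreeAt x A N → FreeAt x A (.letUnit M N)

/-- `x` occurs free in `M`. -/
def Free (x : ℕ) (M : Tm) : Prop := ∃ A, FreeAt x A M

/-- `x` occurs as a bound variable (binder) somewhere in `M`. -/
inductive BoundIn (x : ℕ) : Tm → Prop where
  | lamB (n : ℕ) (A : Ty) (M : Tm) : BoundIn x (.lam n x A M)
  | lamI {M : Tm} (n y : ℕ) (A : Ty) : BoundIn x M → BoundIn x (.lam n y A M)
  | appL {M : Tm} (N : Tm) : BoundIn x M → BoundIn x (.app M N)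
  | appR {N : Tm} (M : Tm) : BoundIn x N → BoundIn x (.app M N)
  | pairL {M : Tm} (n : ℕ) (N : Tm) : BoundIn x M → BoundIn x (.pair n M N)
  | pairR {N : Tm} (n : ℕ) (M : Tm) : BoundIn x N → BoundIn x (.pair n M N)
  | letvB (A : Ty) (M N : Tm) : BoundIn x (.letv x A M N)
  | letvL {M : Tm} (y : ℕ) (A : Ty) (N : Tm) : BoundIn x M → BoundIn x (.letv y A M N)
  | letvR {N : Tm} (y : ℕ) (A : Ty) (M : Tm) : BoundIn x N → BoundIn x (.letv y A M N)
  | letPairB1 (n : ℕ) (A : Ty) (z : ℕ) (B : Ty) (M N : Tm) :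
      BoundIn x (.letPair n x A z B M N)
  | letPairB2 (n y : ℕ) (A : Ty) (B : Ty) (M N : Tm) :
      BoundIn x (.letPair n y A x B M N)
  | letPairL {M : Tm} (n y : ℕ) (A : Ty) (z : ℕ) (B : Ty) (N : Tm) :
      BoundIn x M → BoundIn x (.letPair n y A z B M N)
  | letPairR {N : Tm} (n y : ℕ) (A : Ty) (z : ℕ) (B : Ty) (M : Tm) :
      BoundIn x N → BoundIn x (.letPair n y A z B M N)
  | letUnitL {M : Tm} (N : Tm) : BoundIn x M → BoundIn x (.letUnit M N)
  | letUnitR {N : Tm} (M : Tm) : BoundIn x N → BoundIn x (.letUnit M N)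

/-- Capture-avoiding (up to the usual variable conventions) substitution on untyped terms. -/
def psubst (x : ℕ) (V : PTm) : PTm → PTm
  | .var y => if y = x then V else .var y
  | .cst c => .cst c
  | .star => .star
  | .lam y M => if y = x then .lam y M else .lam y (psubst x V M)
  | .app M N => .app (psubst x V M) (psubst x V N)
  | .pair M N => .pair (psubst x V M) (psubst x V N)
  | .letv y M N => .letv y (psubst x V M) (if y = x then N else psubst x V N)
  | .letPair y z M N =>
      .letPair y z (psubst x V M) (if y = x ∨ z = x then N else psubst x V N)
  | .letUnit M N => .letUnit (psubst x V M) (psubst x V N)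

/-- Typing contexts: finite partial assignments of types to variables. -/
abbrev Ctx : Type := ℕ → Option Ty

/-- The empty context. -/
def emptyC : Ctx := fun _ => none

/-- Context extension `Δ, x:A`. -/
def extC (Δ : Ctx) (x : ℕ) (A : Ty) : Ctx := fun y => if y = x then some A else Δ y

/-- Disjointness of contexts. -/
def DisjC (Γ₁ Γ₂ : Ctx) : Prop := ∀ x, Γ₁ x = none ∨ Γ₂ x = none

/-- Union of contexts (left-biased; used on disjoint contexts). -/
def unionC (Γ₁ Γ₂ : Ctx) : Ctx := fun x => (Γ₁ x).orElse (fun _ => Γ₂ x)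

/-- `Δ` is of the form `!Δ'`: every type occurring in `Δ` is of the form `!B`. -/
def IsBangC (Δ : Ctx) : Prop := ∀ x A, Δ x = some A → ∃ B, A = Ty.bang B

/-- `!Δ`, obtained from `Δ` by prefixing every type with `!`. -/
def bangifyC (Δ : Ctx) : Ctx := fun x => (Δ x).map Ty.bang

/-- The typing rules of Table 1.  The parameter `cty` assigns to each constant `c`
    the type `A_c`; the type assigned to `c` is `!A_c`. -/
inductive Typing (cty : ℕ → Ty) : Ctx → Tm → Ty → Prop where
  | var {Δ : Ctx} {x : ℕ} {A B : Ty} :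
      IsBangC Δ → Δ x = none → Sub A B →
      Typing cty (extC Δ x A) (.var x B) B
  | cst {Δ : Ctx} {c : ℕ} {B : Ty} :
      IsBangC Δ → Sub (.bang (cty c)) B →
      Typing cty Δ (.cst c B) B
  | star {Δ : Ctx} {n : ℕ} :
      IsBangC Δ →
      Typing cty Δ (.star n) (bangN n .unit)
  | lam0 {Δ : Ctx} {x : ℕ} {A : Ty} {M : Tm} {B : Ty} :
      Δ x = none → Typing cty (extC Δ x A) M B →
      Typing cty Δ (.lam 0 x A M) (.arrow A B)
  | lamS {Δ : Ctx} {n x : ℕ} {A : Ty} {M : Tm} {B : Ty} :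
      IsBangC Δ → Δ x = none → Typing cty (extC Δ x A) M B →
      Typing cty Δ (.lam (n + 1) x A M) (bangN (n + 1) (.arrow A B))
  | app {Δ Γ₁ Γ₂ : Ctx} {M N : Tm} {A B : Ty} :
      IsBangC Δ → DisjC Γ₁ Γ₂ → DisjC Γ₁ Δ → DisjC Γ₂ Δ →
      Typing cty (unionC Γ₁ Δ) M (.arrow A B) →
      Typing cty (unionC Γ₂ Δ) N A →
      Typing cty (unionC Γ₁ (unionC Γ₂ Δ)) (.app M N) B
  | pair {Δ Γ₁ Γ₂ : Ctx} {n : ℕ} {M₁ M₂ : Tm} {A₁ A₂ : Ty} :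
      IsBangC Δ → DisjC Γ₁ Γ₂ → DisjC Γ₁ Δ → DisjC Γ₂ Δ →
      Typing cty (unionC Γ₁ Δ) M₁ (bangN n A₁) →
      Typing cty (unionC Γ₂ Δ) M₂ (bangN n A₂) →
      Typing cty (unionC Γ₁ (unionC Γ₂ Δ)) (.pair n M₁ M₂) (bangN n (.tensor A₁ A₂))
  | letv {Δ Γ₁ Γ₂ : Ctx} {x : ℕ} {A : Ty} {M N : Tm} {B : Ty} :
      IsBangC Δ → DisjC Γ₁ Γ₂ → DisjC Γ₁ Δ → DisjC Γ₂ Δ →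
      (unionC Γ₁ (unionC Γ₂ Δ)) x = none →
      Typing cty (unionC Γ₁ Δ) M A →
      Typing cty (extC (unionC Γ₂ Δ) x A) N B →
      Typing cty (unionC Γ₁ (unionC Γ₂ Δ)) (.letv x A M N) B
  | letUnit {Δ Γ₁ Γ₂ : Ctx} {M N : Tm} {A : Ty} :
      IsBangC Δ → DisjC Γ₁ Γ₂ → DisjC Γ₁ Δ → DisjC Γ₂ Δ →
      Typing cty (unionC Γ₁ Δ) M .unit →
      Typing cty (unionC Γ₂ Δ) N A →
      Typing cty (unionC Γ₁ (unionC Γ₂ Δ)) (.letUnit M N) A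
  | letPair {Δ Γ₁ Γ₂ : Ctx} {n x₁ : ℕ} {A₁ : Ty} {x₂ : ℕ} {A₂ : Ty} {M N : Tm} {A : Ty} :
      IsBangC Δ → DisjC Γ₁ Γ₂ → DisjC Γ₁ Δ → DisjC Γ₂ Δ →
      x₁ ≠ x₂ →
      (unionC Γ₁ (unionC Γ₂ Δ)) x₁ = none →
      (unionC Γ₁ (unionC Γ₂ Δ)) x₂ = none →
      Typing cty (unionC Γ₁ Δ) M (bangN n (.tensor A₁ A₂)) →
      Typing cty (extC (extC (unionC Γ₂ Δ) x₁ (bangN n A₁)) x₂ (bangN n A₂)) N A →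
      Typing cty (unionC Γ₁ (unionC Γ₂ Δ)) (.letPair n x₁ A₁ x₂ A₂ M N) A

/-- Pointwise subtyping of contexts with the same variables: `Δ' <: Δ`. -/
def SubCtx (Δ' Δ : Ctx) : Prop :=
  (∀ x, Δ x = none → Δ' x = none) ∧
  (∀ x A, Δ x = some A → ∃ A', Δ' x = some A' ∧ Sub A' A)

end QLam

namespace QLam

/-- `A` is not of the form `!B`. -/
def NotBang (A : Ty) : Prop := ∀ B, A ≠ Ty.bang B

theorem notBang_tconst (a : ℕ) : NotBang (.tconst a) := fun _ h => Ty.noConfusion h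

theorem notBang_unit : NotBang .unit := fun _ h => Ty.noConfusion h

theorem notBang_arrow (A B : Ty) : NotBang (.arrow A B) := fun _ h => Ty.noConfusion h

theorem notBang_tensor (A B : Ty) : NotBang (.tensor A B) := fun _ h => Ty.noConfusion h

theorem bangN_inj {X Y : Ty} (hX : NotBang X) (hY : NotBang Y) :
    ∀ {n m : ℕ}, bangN n X = bangN m Y → n = m ∧ X = Y
  | 0, 0, h => ⟨rfl, h⟩
  | 0, _ + 1, h => absurd h (hX _)
  | _ + 1, 0, h => absurd h.symm (hY _)
  | _ + 1, _ + 1, h => by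
    obtain ⟨h₁, h₂⟩ := bangN_inj hX hY (Ty.bang.inj h)
    exact ⟨by rw [h₁], h₂⟩

/-- Transitivity of subtyping on both sides of a given judgment; the two halves are proved
together because the arrow is contravariant in its domain. -/
theorem Sub.trans_both {A B : Ty} (h : Sub A B) :
    (∀ C, Sub B C → Sub A C) ∧ (∀ C, Sub C A → Sub C B) := by
  induction h with
  | tconst n m a hnm =>
    constructor <;> intro C hC
    · generalize hX : bangN m (Ty.tconst a) = X at hC
      cases hC with
      | tconst n' m' b h' =>
        obtain ⟨rfl, h⟩ := bangN_inj (notBang_tconst _) (notBang_tconst _) hX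
        cases h
        exact .tconst _ _ _ (by omega)
      | unit n' m' h' => cases (bangN_inj (notBang_tconst _) notBang_unit hX).2
      | arrow => cases (bangN_inj (notBang_tconst _) (notBang_arrow _ _) hX).2
      | tensor => cases (bangN_inj (notBang_tconst _) (notBang_tensor _ _) hX).2
    · generalize hX : bangN n (Ty.tconst a) = X at hC
      cases hC with
      | tconst n' m' b h' =>
        obtain ⟨rfl, h⟩ := bangN_inj (notBang_tconst _) (notBang_tconst _) hX
        cases h
        exact .tconst _ _ _ (by omega)
      | unit n' m' h' => cases (bangN_inj (notBang_tconst _) notBang_unit hX).2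
      | arrow => cases (bangN_inj (notBang_tconst _) (notBang_arrow _ _) hX).2
      | tensor => cases (bangN_inj (notBang_tconst _) (notBang_tensor _ _) hX).2
  | unit n m hnm =>
    constructor <;> intro C hC
    · generalize hX : bangN m Ty.unit = X at hC
      cases hC with
      | unit n' m' h' =>
        obtain ⟨rfl, h⟩ := bangN_inj notBang_unit notBang_unit hX
        exact .unit _ _ (by omega)
      | tconst => cases (bangN_inj notBang_unit (notBang_tconst _) hX).2
      | arrow => cases (bangN_inj notBang_unit (notBang_arrow _ _) hX).2
      | tensor => cases (bangN_inj notBang_unit (notBang_tensor _ _) hX).2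
    · generalize hX : bangN n Ty.unit = X at hC
      cases hC with
      | unit n' m' h' =>
        obtain ⟨rfl, h⟩ := bangN_inj notBang_unit notBang_unit hX
        exact .unit _ _ (by omega)
      | tconst => cases (bangN_inj notBang_unit (notBang_tconst _) hX).2
      | arrow => cases (bangN_inj notBang_unit (notBang_arrow _ _) hX).2
      | tensor => cases (bangN_inj notBang_unit (notBang_tensor _ _) hX).2
  | arrow n m A A' B B' hnm _ _ ihA ihB =>
    constructor <;> intro C hC
    · generalize hX : bangN m (Ty.arrow A B') = X at hC
      cases hC with
      | arrow n' m' D D' E E' h' hD hE =>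
        obtain ⟨rfl, h⟩ := bangN_inj (notBang_arrow _ _) (notBang_arrow _ _) hX
        cases h
        exact .arrow _ _ _ _ _ _ (by omega) (ihA.2 _ hD) (ihB.1 _ hE)
      | tconst => cases (bangN_inj (notBang_arrow _ _) (notBang_tconst _) hX).2
      | unit => cases (bangN_inj (notBang_arrow _ _) notBang_unit hX).2
      | tensor => cases (bangN_inj (notBang_arrow _ _) (notBang_tensor _ _) hX).2
    · generalize hX : bangN n (Ty.arrow A' B) = X at hC
      cases hC with
      | arrow n' m' D D' E E' h' hD hE =>
        obtain ⟨rfl, h⟩ := bangN_inj (notBang_arrow _ _) (notBang_arrow _ _) hX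
        cases h
        exact .arrow _ _ _ _ _ _ (by omega) (ihA.1 _ hD) (ihB.2 _ hE)
      | tconst => cases (bangN_inj (notBang_arrow _ _) (notBang_tconst _) hX).2
      | unit => cases (bangN_inj (notBang_arrow _ _) notBang_unit hX).2
      | tensor => cases (bangN_inj (notBang_arrow _ _) (notBang_tensor _ _) hX).2
  | tensor n m A A' B B' hnm _ _ ihA ihB =>
    constructor <;> intro C hC
    · generalize hX : bangN m (Ty.tensor A' B') = X at hC
      cases hC with
      | tensor n' m' D D' E E' h' hD hE =>
        obtain ⟨rfl, h⟩ := bangN_inj (notBang_tensor _ _) (notBang_tensor _ _) hX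
        cases h
        exact .tensor _ _ _ _ _ _ (by omega) (ihA.1 _ hD) (ihB.1 _ hE)
      | tconst => cases (bangN_inj (notBang_tensor _ _) (notBang_tconst _) hX).2
      | unit => cases (bangN_inj (notBang_tensor _ _) notBang_unit hX).2
      | arrow => cases (bangN_inj (notBang_tensor _ _) (notBang_arrow _ _) hX).2
    · generalize hX : bangN n (Ty.tensor A B) = X at hC
      cases hC with
      | tensor n' m' D D' E E' h' hD hE =>
        obtain ⟨rfl, h⟩ := bangN_inj (notBang_tensor _ _) (notBang_tensor _ _) hX
        cases h
        exact .tensor _ _ _ _ _ _ (by omega) (ihA.2 _ hD) (ihB.2 _ hE)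
      | tconst => cases (bangN_inj (notBang_tensor _ _) (notBang_tconst _) hX).2
      | unit => cases (bangN_inj (notBang_tensor _ _) notBang_unit hX).2
      | arrow => cases (bangN_inj (notBang_tensor _ _) (notBang_arrow _ _) hX).2

theorem Sub.trans {A B C : Ty} (h : Sub A B) (h' : Sub B C) : Sub A C :=
  h.trans_both.1 C h'

theorem Sub.bang {A B : Ty} (h : Sub A B) : Sub (.bang A) (.bang B) := by
  cases h with
  | tconst n m a => exact .tconst (n + 1) (m + 1) a (by omega)
  | unit n m => exact .unit (n + 1) (m + 1) (by omega)
  | arrow n m A A' B B' _ hA hB => exact .arrow (n + 1) (m + 1) _ _ _ _ (by omega) hA hB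
  | tensor n m A A' B B' _ hA hB => exact .tensor (n + 1) (m + 1) _ _ _ _ (by omega) hA hB

/-- Subtypes of a `!`-type are `!`-types. -/
theorem Sub.exists_bang {A B : Ty} (h : Sub A (.bang B)) : ∃ C, A = .bang C := by
  generalize hX : Ty.bang B = X at h
  cases h with
  | tconst n m a h =>
    obtain _ | n := n
    · obtain rfl : m = 0 := by omega
      cases hX
    · exact ⟨_, rfl⟩
  | unit n m h =>
    obtain _ | n := n
    · obtain rfl : m = 0 := by omega
      cases hX
    · exact ⟨_, rfl⟩
  | arrow n m A A' B B' h =>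
    obtain _ | n := n
    · obtain rfl : m = 0 := by omega
      cases hX
    · exact ⟨_, rfl⟩
  | tensor n m A A' B B' h =>
    obtain _ | n := n
    · obtain rfl : m = 0 := by omega
      cases hX
    · exact ⟨_, rfl⟩

/-- A supertype of a `!`-type remains one when prefixed with `!`. -/
theorem Sub.bang_right {A B : Ty} (h : Sub (.bang A) B) : Sub (.bang A) (.bang B) := by
  generalize hX : Ty.bang A = X at h ⊢
  cases h with
  | tconst n m a h =>
    obtain _ | n := n
    · cases hX
    · exact .tconst (n + 1) (m + 1) a (by omega)
  | unit n m h =>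
    obtain _ | n := n
    · cases hX
    · exact .unit (n + 1) (m + 1) (by omega)
  | arrow n m A A' B B' h hA hB =>
    obtain _ | n := n
    · cases hX
    · exact .arrow (n + 1) (m + 1) _ _ _ _ (by omega) hA hB
  | tensor n m A A' B B' h hA hB =>
    obtain _ | n := n
    · cases hX
    · exact .tensor (n + 1) (m + 1) _ _ _ _ (by omega) hA hB

theorem Sub.refl : ∀ A : Ty, Sub A A
  | .tconst a => .tconst 0 0 a (by omega)
  | .unit => .unit 0 0 (by omega)
  | .arrow A B => .arrow 0 0 _ _ _ _ (by omega) (Sub.refl A) (Sub.refl B)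
  | .tensor A B => .tensor 0 0 _ _ _ _ (by omega) (Sub.refl A) (Sub.refl B)
  | .bang A => (Sub.refl A).bang

/-- Dereliction: `!A <: A`. -/
theorem Sub.derelict (A : Ty) : Sub (.bang A) A := by
  have key : ∀ {B}, Sub A B → Sub (.bang A) B := by
    intro B h
    cases h with
    | tconst n m a => exact .tconst (n + 1) m a (by omega)
    | unit n m => exact .unit (n + 1) m (by omega)
    | arrow n m A A' B B' _ hA hB => exact .arrow (n + 1) m _ _ _ _ (by omega) hA hB
    | tensor n m A A' B B' _ hA hB => exact .tensor (n + 1) m _ _ _ _ (by omega) hA hB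
  exact key (Sub.refl A)

theorem isBangC_bangifyC (Δ : Ctx) : IsBangC (bangifyC Δ) := by
  intro x A h
  simp only [bangifyC, Option.map_eq_some_iff] at h
  obtain ⟨B, _, rfl⟩ := h
  exact ⟨B, rfl⟩

theorem bangifyC_eq_none {Δ : Ctx} {x : ℕ} : bangifyC Δ x = none ↔ Δ x = none := by
  simp [bangifyC]

theorem bangifyC_extC (Δ : Ctx) (x : ℕ) (A : Ty) :
    bangifyC (extC Δ x A) = extC (bangifyC Δ) x (.bang A) := by
  funext y
  by_cases h : y = x <;> simp [bangifyC, extC, h]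

theorem bangifyC_unionC (Γ Δ : Ctx) :
    bangifyC (unionC Γ Δ) = unionC (bangifyC Γ) (bangifyC Δ) := by
  funext y
  cases h : Γ y <;> simp [bangifyC, unionC, h]

theorem DisjC.bangifyC {Γ Δ : Ctx} (h : DisjC Γ Δ) :
    DisjC (bangifyC Γ) (bangifyC Δ) :=
  fun x => (h x).imp bangifyC_eq_none.2 bangifyC_eq_none.2

theorem subCtx_bangifyC (Δ : Ctx) : SubCtx (bangifyC Δ) Δ :=
  ⟨fun _ => bangifyC_eq_none.2, fun x A h => ⟨.bang A, by simp [bangifyC, h], Sub.derelict A⟩⟩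

theorem SubCtx.isBangC {Δ' Δ : Ctx} (h : SubCtx Δ' Δ) (hΔ : IsBangC Δ) : IsBangC Δ' := by
  intro x A hA
  cases hx : Δ x with
  | none => simp [h.1 x hx] at hA
  | some B =>
    obtain ⟨A', hA', hs⟩ := h.2 x B hx
    obtain ⟨C, rfl⟩ := hΔ x B hx
    obtain rfl : A = A' := by simpa [hA] using hA'
    exact hs.exists_bang

theorem SubCtx.extC {Δ' Δ : Ctx} (h : SubCtx Δ' Δ) (x : ℕ) (A : Ty) :
    SubCtx (extC Δ' x A) (extC Δ x A) := by
  constructor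
  · intro y hy
    by_cases hxy : y = x
    · simp [QLam.extC, hxy] at hy
    · simp only [QLam.extC, hxy, if_false] at hy ⊢
      exact h.1 y hy
  · intro y B hy
    by_cases hxy : y = x
    · simp only [QLam.extC, hxy, if_true] at hy ⊢
      exact ⟨B, hy, Sub.refl B⟩
    · simp only [QLam.extC, hxy, if_false] at hy ⊢
      exact h.2 y B hy

/-- The restriction of `Δ` to the domain of `Γ`. -/
def restrictC (Δ Γ : Ctx) : Ctx := fun x => if Γ x = none then none else Δ x

theorem restrictC_eq_none {Δ Γ : Ctx} {x : ℕ} (h : Γ x = none) : restrictC Δ Γ x = none := by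
  simp [restrictC, h]

theorem DisjC.restrictC {Γ₁ Γ₂ : Ctx} (h : DisjC Γ₁ Γ₂) (Δ : Ctx) :
    DisjC (restrictC Δ Γ₁) (restrictC Δ Γ₂) :=
  fun x => (h x).imp restrictC_eq_none restrictC_eq_none

theorem restrictC_unionC (Δ Γ₁ Γ₂ : Ctx) :
    restrictC Δ (unionC Γ₁ Γ₂) = unionC (restrictC Δ Γ₁) (restrictC Δ Γ₂) := by
  funext x
  cases h₁ : Γ₁ x <;> cases h₂ : Γ₂ x <;> cases h : Δ x <;>
    simp [restrictC, unionC, h₁, h₂, h]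

theorem SubCtx.restrictC_eq {Δ' Δ : Ctx} (h : SubCtx Δ' Δ) : restrictC Δ' Δ = Δ' := by
  funext x
  by_cases hx : Δ x = none
  · simp [restrictC, hx, h.1 x hx]
  · simp [restrictC, hx]

/-- Restricting a subcontext of `Δ` to a part `Γ` of `Δ` gives a subcontext of `Γ`. -/
theorem SubCtx.restrictC {Δ' Δ Γ : Ctx} (h : SubCtx Δ' Δ)
    (hΓ : ∀ x A, Γ x = some A → Δ x = some A) : SubCtx (restrictC Δ' Γ) Γ := by
  refine ⟨fun x => restrictC_eq_none, fun x A hx => ?_⟩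
  obtain ⟨A', h₁, h₂⟩ := h.2 x A (hΓ x A hx)
  exact ⟨A', by simp [QLam.restrictC, hx, h₁], h₂⟩

/-- A subcontext of `Γ₁, Γ₂, !Δ` splits along the three parts. -/
theorem SubCtx.split {Θ Γ₁ Γ₂ Δ : Ctx} (h : SubCtx Θ (unionC Γ₁ (unionC Γ₂ Δ)))
    (hΔ : IsBangC Δ) (h₁₂ : DisjC Γ₁ Γ₂) (h₁ : DisjC Γ₁ Δ) (h₂ : DisjC Γ₂ Δ) :
    ∃ Γ₁' Γ₂' Δ', Θ = unionC Γ₁' (unionC Γ₂' Δ') ∧ IsBangC Δ' ∧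
      DisjC Γ₁' Γ₂' ∧ DisjC Γ₁' Δ' ∧ DisjC Γ₂' Δ' ∧
      SubCtx (unionC Γ₁' Δ') (unionC Γ₁ Δ) ∧ SubCtx (unionC Γ₂' Δ') (unionC Γ₂ Δ) := by
  refine ⟨QLam.restrictC Θ Γ₁, QLam.restrictC Θ Γ₂, QLam.restrictC Θ Δ, ?_, ?_,
    h₁₂.restrictC Θ, h₁.restrictC Θ, h₂.restrictC Θ, ?_, ?_⟩
  · rw [← restrictC_unionC, ← restrictC_unionC, h.restrictC_eq]
  · refine SubCtx.isBangC (h.restrictC ?_) hΔ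
    intro x A hx
    have a := h₁ x
    have b := h₂ x
    simp_all [unionC]
  · rw [← restrictC_unionC]
    refine h.restrictC ?_
    intro x A hx
    have a := h₁₂ x
    have b := h₂ x
    cases hx₁ : Γ₁ x <;> simp_all [unionC]
  · rw [← restrictC_unionC]
    refine h.restrictC ?_
    intro x A hx
    have a := h₁₂ x
    have b := h₁ x
    cases hx₁ : Γ₁ x <;> simp_all [unionC]

/-- Typing is antitone in the context with respect to subtyping. -/
theorem Typing.of_subCtx {cty : ℕ → Ty} {Δ : Ctx} {M : Tm} {A : Ty} (h : Typing cty Δ M A) :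
    ∀ {Θ : Ctx}, SubCtx Θ Δ → Typing cty Θ M A := by
  induction h with
  | @var Δ x A B hΔ hx hs =>
    intro Θ hΘ
    obtain ⟨A', hA', hs'⟩ := hΘ.2 x A (by simp [extC])
    have hΘ' : Θ = extC (restrictC Θ Δ) x A' := by
      funext y
      by_cases hy : y = x
      · simp [extC, hy, hA']
      · have := hΘ.1 y
        simp only [extC, hy, if_false] at this
        by_cases hn : Δ y = none <;> simp [extC, restrictC, hy, hn, this]
    rw [hΘ']
    refine .var (SubCtx.isBangC (hΘ.restrictC ?_) hΔ) (restrictC_eq_none hx) (hs'.trans hs)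
    intro y C hy
    have : y ≠ x := by rintro rfl; simp [hx] at hy
    simp [extC, this, hy]
  | cst hΔ hs => exact fun hΘ => .cst (hΘ.isBangC hΔ) hs
  | star hΔ => exact fun hΘ => .star (hΘ.isBangC hΔ)
  | lam0 hx _ ih => exact fun hΘ => .lam0 (hΘ.1 _ hx) (ih (hΘ.extC _ _))
  | lamS hΔ hx _ ih => exact fun hΘ => .lamS (hΘ.isBangC hΔ) (hΘ.1 _ hx) (ih (hΘ.extC _ _))
  | app hΔ h₁₂ h₁ h₂ _ _ ih₁ ih₂ =>
    intro Θ hΘ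
    obtain ⟨Γ₁', Γ₂', Δ', rfl, hb, d₁₂, d₁, d₂, s₁, s₂⟩ := hΘ.split hΔ h₁₂ h₁ h₂
    exact .app hb d₁₂ d₁ d₂ (ih₁ s₁) (ih₂ s₂)
  | pair hΔ h₁₂ h₁ h₂ _ _ ih₁ ih₂ =>
    intro Θ hΘ
    obtain ⟨Γ₁', Γ₂', Δ', rfl, hb, d₁₂, d₁, d₂, s₁, s₂⟩ := hΘ.split hΔ h₁₂ h₁ h₂
    exact .pair hb d₁₂ d₁ d₂ (ih₁ s₁) (ih₂ s₂)
  | letv hΔ h₁₂ h₁ h₂ hx _ _ ih₁ ih₂ =>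
    intro Θ hΘ
    have hx' := hΘ.1 _ hx
    obtain ⟨Γ₁', Γ₂', Δ', rfl, hb, d₁₂, d₁, d₂, s₁, s₂⟩ := hΘ.split hΔ h₁₂ h₁ h₂
    exact .letv hb d₁₂ d₁ d₂ hx' (ih₁ s₁) (ih₂ (s₂.extC _ _))
  | letUnit hΔ h₁₂ h₁ h₂ _ _ ih₁ ih₂ =>
    intro Θ hΘ
    obtain ⟨Γ₁', Γ₂', Δ', rfl, hb, d₁₂, d₁, d₂, s₁, s₂⟩ := hΘ.split hΔ h₁₂ h₁ h₂
    exact .letUnit hb d₁₂ d₁ d₂ (ih₁ s₁) (ih₂ s₂)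
  | letPair hΔ h₁₂ h₁ h₂ hne hx hy _ _ ih₁ ih₂ =>
    intro Θ hΘ
    have hx' := hΘ.1 _ hx
    have hy' := hΘ.1 _ hy
    obtain ⟨Γ₁', Γ₂', Δ', rfl, hb, d₁₂, d₁, d₂, s₁, s₂⟩ := hΘ.split hΔ h₁₂ h₁ h₂
    exact .letPair hb d₁₂ d₁ d₂ hne hx' hy' (ih₁ s₁) (ih₂ ((s₂.extC _ _).extC _ _))

/-- **Promotion.** Given a valid typing judgment `Δ ⊢ V : A` where `V`
is a value, there exists a canonical value `V'` with the same erasure as `V` such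
that `!Δ ⊢ V' : !A` is a valid typing judgment (where `!Δ` is obtained from `Δ` by
prefixing every type with `!`). -/
theorem promotion (cty : ℕ → Ty) (Δ : Ctx) (V : Tm) (A : Ty)
    (hV : IsValue V) (h : Typing cty Δ V A) :
    ∃ V' : Tm, IsValue V' ∧ erase V' = erase V ∧
      Typing cty (bangifyC Δ) V' (Ty.bang A) := by
  induction h with
  | @var Δ x A B _ hx hs =>
    refine ⟨.var x (.bang B), .core (.var _ _), rfl, ?_⟩
    rw [bangifyC_extC]
    exact .var (isBangC_bangifyC _) (bangifyC_eq_none.2 hx) hs.bang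
  | @cst Δ c B _ hs =>
    exact ⟨.cst c (.bang B), .core (.cst _ _), rfl, .cst (isBangC_bangifyC _) hs.bang_right⟩
  | @star Δ n _ =>
    exact ⟨.star (n + 1), .core (.star _), rfl, .star (n := n + 1) (isBangC_bangifyC _)⟩
  | @lam0 Δ x A M B hx hM _ =>
    exact ⟨.lam 1 x A M, .core (.lam _ _ _ _), rfl,
      .lamS (n := 0) (isBangC_bangifyC _) (bangifyC_eq_none.2 hx)
        (hM.of_subCtx ((subCtx_bangifyC Δ).extC _ _))⟩
  | @lamS Δ n x A M B _ hx hM _ =>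
    exact ⟨.lam (n + 2) x A M, .core (.lam _ _ _ _), rfl,
      .lamS (n := n + 1) (isBangC_bangifyC _) (bangifyC_eq_none.2 hx)
        (hM.of_subCtx ((subCtx_bangifyC Δ).extC _ _))⟩
  | app => obtain ⟨⟨⟩⟩ := hV
  | @pair Δ Γ₁ Γ₂ n M₁ M₂ A₁ A₂ _ h₁₂ h₁ h₂ _ _ ih₁ ih₂ =>
    obtain ⟨hV₁, hV₂⟩ : IsValue M₁ ∧ IsValue M₂ := by
      cases hV with
      | core hU => cases hU
      | pair _ hV₁ hV₂ => exact ⟨hV₁, hV₂⟩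
    obtain ⟨V₁, v₁, e₁, t₁⟩ := ih₁ hV₁
    obtain ⟨V₂, v₂, e₂, t₂⟩ := ih₂ hV₂
    refine ⟨.pair (n + 1) V₁ V₂, .pair _ v₁ v₂, by simp [erase, e₁, e₂], ?_⟩
    rw [bangifyC_unionC] at t₁ t₂
    rw [bangifyC_unionC, bangifyC_unionC]
    exact .pair (n := n + 1) (isBangC_bangifyC _) h₁₂.bangifyC h₁.bangifyC h₂.bangifyC t₁ t₂
  | @letv Δ Γ₁ Γ₂ x A M N B _ h₁₂ h₁ h₂ hx _ _ ih₁ ih₂ =>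
    obtain ⟨hV₁, hV₂⟩ : IsValue M ∧ IsValue N := by
      cases hV with
      | core hU => cases hU
      | letv _ _ hV₁ hV₂ => exact ⟨hV₁, hV₂⟩
    obtain ⟨V₁, v₁, e₁, t₁⟩ := ih₁ hV₁
    obtain ⟨V₂, v₂, e₂, t₂⟩ := ih₂ hV₂
    refine ⟨.letv x (.bang A) V₁ V₂, .letv _ _ v₁ v₂, by simp [erase, e₁, e₂], ?_⟩
    have hx' := bangifyC_eq_none.2 hx
    rw [bangifyC_unionC] at t₁
    rw [bangifyC_extC, bangifyC_unionC] at t₂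
    rw [bangifyC_unionC, bangifyC_unionC] at hx' ⊢
    exact .letv (isBangC_bangifyC _) h₁₂.bangifyC h₁.bangifyC h₂.bangifyC hx' t₁ t₂
  | @letUnit Δ Γ₁ Γ₂ M N A _ h₁₂ h₁ h₂ hM _ _ ih₂ =>
    obtain ⟨hV₁, hV₂⟩ : IsValue M ∧ IsValue N := by
      cases hV with
      | core hU => cases hU
      | letUnit hV₁ hV₂ => exact ⟨hV₁, hV₂⟩
    obtain ⟨V₂, v₂, e₂, t₂⟩ := ih₂ hV₂
    refine ⟨.letUnit M V₂, .letUnit hV₁ v₂, by simp [erase, e₂], ?_⟩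
    have t₁ := hM.of_subCtx (subCtx_bangifyC _)
    rw [bangifyC_unionC] at t₁ t₂
    rw [bangifyC_unionC, bangifyC_unionC]
    exact .letUnit (isBangC_bangifyC _) h₁₂.bangifyC h₁.bangifyC h₂.bangifyC t₁ t₂
  | @letPair Δ Γ₁ Γ₂ n x₁ A₁ x₂ A₂ M N A _ h₁₂ h₁ h₂ hne hx₁ hx₂ _ _ ih₁ ih₂ =>
    obtain ⟨hV₁, hV₂⟩ : IsValue M ∧ IsValue N := by
      cases hV with
      | core hU => cases hU
      | letPair _ _ _ _ _ hV₁ hV₂ => exact ⟨hV₁, hV₂⟩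
    obtain ⟨V₁, v₁, e₁, t₁⟩ := ih₁ hV₁
    obtain ⟨V₂, v₂, e₂, t₂⟩ := ih₂ hV₂
    refine ⟨.letPair (n + 1) x₁ A₁ x₂ A₂ V₁ V₂, .letPair _ _ _ _ _ v₁ v₂,
      by simp [erase, e₁, e₂], ?_⟩
    have hx₁' := bangifyC_eq_none.2 hx₁
    have hx₂' := bangifyC_eq_none.2 hx₂
    rw [bangifyC_unionC] at t₁
    rw [bangifyC_extC, bangifyC_extC, bangifyC_unionC] at t₂
    rw [bangifyC_unionC, bangifyC_unionC] at hx₁' hx₂' ⊢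
    exact .letPair (n := n + 1) (isBangC_bangifyC _) h₁₂.bangifyC h₁.bangifyC h₂.bangifyC hne
      hx₁' hx₂' t₁ t₂

end QLam
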